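/- arXiv:1910.04276 — 2 statements merged into one kernel-verified Lean document; each statement's English description precedes it below -/
import Mathlib

section
/- Let 0 < α < 1 and let f be a Schwartz function on ℝ with f(log(n+1)) = f(-log(n+1)) = 0 and f̂(n^α) = f̂(-n^α) = 0 for every natural number n ≥ 0. Then for every natural number k ≥ 1 and every x with |x| > log(k+1), one has |f(x)| ≤ k (2π)^k ((k+1)!)³ I_k(f̂) e^{−k|x|}, where I_k(f̂) = ∫_ℝ |f̂(y)| |y|^k dy. -/
open MeasureTheory

/-- The Fourier transform `f̂(ξ) = ∫_ℝ f(x) e^{2πi x ξ} dx`. -/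
noncomputable def fourierTransform (f : ℝ → ℂ) (ξ : ℝ) : ℂ :=
  ∫ x : ℝ, f x * Complex.exp (2 * Real.pi * Complex.I * x * ξ)

/-- The weighted integral `I_k(g) = ∫_ℝ |g(y)| |y|^k dy`. -/
noncomputable def weightedIntegral (g : ℝ → ℂ) (k : ℕ) : ℝ :=
  ∫ y : ℝ, ‖g y‖ * |y| ^ k

open FourierTransform in
/-- The Fourier transform with the positive sign convention is Mathlib's inverse transform. -/
lemma fourierTransform_eq_fourierInv (f : SchwartzMap ℝ ℂ) :
    fourierTransform f = ((𝓕⁻ f : SchwartzMap ℝ ℂ) : ℝ → ℂ) := by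
  ext ξ
  rw [SchwartzMap.fourierInv_coe, Real.fourierInv_eq', fourierTransform]
  congr 1 with x
  rw [smul_eq_mul, mul_comm]
  congr 2
  simp
  ring

open FourierTransform in
/-- The derivatives of a Schwartz function are bounded by the moments of its transform. -/
lemma norm_iteratedDeriv_le_weightedIntegral (f : SchwartzMap ℝ ℂ) (k : ℕ) (x : ℝ) :
    ‖iteratedDeriv k f x‖ ≤ (2 * Real.pi) ^ k * weightedIntegral (fourierTransform f) k := by
  rw [fourierTransform_eq_fourierInv]
  set g : SchwartzMap ℝ ℂ := 𝓕⁻ f with hg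
  have hfg : (f : ℝ → ℂ) = 𝓕 (g : ℝ → ℂ) := by
    rw [← SchwartzMap.fourier_coe, hg, FourierTransform.fourier_fourierInv_eq]
  have hint (n : ℕ) : Integrable (fun y : ℝ ↦ y ^ n • g y) := by
    have h := g.integrable_pow_mul volume n
    refine h.mono' (by fun_prop) (ae_of_all _ fun y ↦ ?_)
    simp
  rw [hfg, Real.iteratedDeriv_fourier (N := ⊤) (fun n _ ↦ hint n) le_top, Real.fourier_eq',
    weightedIntegral, ← integral_const_mul]
  refine (norm_integral_le_integral_norm _).trans (le_of_eq ?_)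
  congr 1 with y
  rw [norm_smul, norm_smul, Complex.norm_exp_ofReal_mul_I]
  simp [abs_of_pos Real.pi_pos]
  ring

/-- Iterated Rolle theorem: a smooth function with `k + 1` zeros has a `k`-th derivative that
vanishes somewhere. -/
lemma exists_iteratedDeriv_eq_zero (k : ℕ) (F : ℝ → ℝ) (hF : ContDiff ℝ (⊤ : ℕ∞) F) (z : ℕ → ℝ)
    (hz : ∀ i < k, z i < z (i + 1)) (h0 : ∀ i ≤ k, F (z i) = 0) :
    ∃ c, iteratedDeriv k F c = 0 := by
  induction k generalizing F z with
  | zero => exact ⟨z 0, by simpa using h0 0 le_rfl⟩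
  | succ k ih =>
    have hR (i : ℕ) : ∃ c, i < k + 1 → (c ∈ Set.Ioo (z i) (z (i + 1)) ∧ deriv F c = 0) := by
      by_cases hi : i < k + 1
      · obtain ⟨c, hc, hc'⟩ := exists_deriv_eq_zero (hz i hi) hF.continuous.continuousOn
          ((h0 i hi.le).trans (h0 (i + 1) hi).symm)
        exact ⟨c, fun _ ↦ ⟨hc, hc'⟩⟩
      · exact ⟨0, fun h ↦ absurd h hi⟩
    choose w hw using hR
    obtain ⟨c, hc⟩ := ih (deriv F) ((contDiff_succ_iff_deriv (n := ((⊤ : ℕ∞) : WithTop ℕ∞))).1 hF).2.2 w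
      (fun i hi ↦ (hw i (by lia)).1.2.trans (hw (i + 1) (by lia)).1.1)
      (fun i hi ↦ (hw i (by lia)).2)
    exact ⟨c, by rw [iteratedDeriv_succ', hc]⟩

open Polynomial in
lemma iteratedDeriv_eval_of_monic (P : ℝ[X]) (hP : P.Monic) (x : ℝ) :
    iteratedDeriv P.natDegree (fun t ↦ P.eval t) x = P.natDegree.factorial := by
  have hit (n : ℕ) : deriv^[n] (fun t ↦ P.eval t) = fun t ↦ (derivative^[n] P).eval t := by
    induction n with
    | zero => rfl
    | succ n ih =>
      rw [Function.iterate_succ_apply', ih, Function.iterate_succ_apply']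
      ext t
      exact Polynomial.deriv _
  rw [iteratedDeriv_eq_iterate, hit]
  have hd : (derivative^[P.natDegree] P).natDegree = 0 := by
    have := natDegree_iterate_derivative P P.natDegree
    lia
  rw [eq_C_of_natDegree_eq_zero hd, coeff_iterate_derivative]
  simp [Nat.descFactorial_self, hP.coeff_natDegree]

/-- Error bound for interpolation of a function by zero at the nodes `z 0 < ⋯ < z (k - 1)`. -/
lemma abs_mul_factorial_le_mul_prod (k : ℕ) (F : ℝ → ℝ) (hF : ContDiff ℝ (⊤ : ℕ∞) F) (z : ℕ → ℝ)
    (hz : ∀ i < k, z i < z (i + 1)) (h0 : ∀ i < k, F (z i) = 0) (M : ℝ)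
    (hM : ∀ c, |iteratedDeriv k F c| ≤ M) (hzk : ∀ i < k, z i < z k) :
    |F (z k)| * k.factorial ≤ M * ∏ i ∈ Finset.range k, (z k - z i) := by
  set P : Polynomial ℝ := ∏ i ∈ Finset.range k, (Polynomial.X - Polynomial.C (z i)) with hPdef
  have hmon : P.Monic := Polynomial.monic_prod_of_monic _ _ fun i _ ↦ Polynomial.monic_X_sub_C _
  have hdeg : P.natDegree = k := by simp [hPdef]
  have heval (t : ℝ) : P.eval t = ∏ i ∈ Finset.range k, (t - z i) := by
    simp [hPdef, Polynomial.eval_prod]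
  have hpos : 0 < P.eval (z k) := by
    rw [heval]
    exact Finset.prod_pos fun i hi ↦ sub_pos.2 (hzk i (Finset.mem_range.1 hi))
  set a := F (z k) / P.eval (z k) with ha
  have hPs : ContDiff ℝ (⊤ : ℕ∞) (fun t ↦ P.eval t) := by
    simpa [Polynomial.aeval_def] using P.contDiff_aeval (𝕜 := ℝ) (⊤ : ℕ∞)
  obtain ⟨c, hc⟩ := exists_iteratedDeriv_eq_zero k (F - fun t ↦ a * P.eval t)
    (hF.sub (contDiff_const.mul hPs)) z hz (by
      intro i hi
      rcases hi.lt_or_eq with hi | rfl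
      · have : P.eval (z i) = 0 := by
          rw [heval]
          exact Finset.prod_eq_zero (Finset.mem_range.2 hi) (sub_self _)
        simp [h0 i hi, this]
      · simp [ha, hpos.ne'])
  have hfac := iteratedDeriv_eval_of_monic P hmon c
  rw [hdeg] at hfac
  rw [iteratedDeriv_sub (hF.contDiffAt.of_le (mod_cast le_top))
    ((contDiff_const.mul hPs).contDiffAt.of_le (mod_cast le_top)), iteratedDeriv_const_mul_field, hfac,
    sub_eq_zero] at hc
  have hMc := hM c
  rw [hc, abs_mul, Nat.abs_cast, ha, abs_div, abs_of_pos hpos, div_mul_eq_mul_div,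
    div_le_iff₀ hpos, heval] at hMc
  exact hMc

/-- The distance from `x` to the logarithm of an integer just below `e^x`. -/
lemma sub_log_le_mul_exp_neg {x a b : ℝ} (ha : 1 ≤ a) (hb : 0 ≤ b) (hx : Real.exp x ≤ a + b) :
    x - Real.log a ≤ b * (b + 1) * Real.exp (-x) := by
  have ha0 : 0 < a := by linarith
  have h1 : x - Real.log a = Real.log (Real.exp x / a) := by
    rw [Real.log_div (Real.exp_ne_zero _) ha0.ne', Real.log_exp]
  have h2 := Real.log_le_sub_one_of_pos (div_pos (Real.exp_pos x) ha0)
  rw [h1, Real.exp_neg, ← div_eq_mul_inv, le_div_iff₀ (Real.exp_pos x)]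
  have h3 : Real.exp x / a ≤ b + 1 := by
    rw [div_le_iff₀ ha0]
    nlinarith
  have h4 : (Real.exp x / a - 1) * Real.exp x = (Real.exp x - a) * (Real.exp x / a) := by
    field_simp
  calc Real.log (Real.exp x / a) * Real.exp x
      ≤ (Real.exp x / a - 1) * Real.exp x := by gcongr
    _ = (Real.exp x - a) * (Real.exp x / a) := h4
    _ ≤ b * (b + 1) := by
      have : 0 ≤ Real.exp x / a := by positivity
      exact mul_le_mul (by linarith) h3 this hb

lemma prod_range_sub_mul_sub_add_one (k : ℕ) :
    ∏ i ∈ Finset.range k, (((k : ℝ) - i) * ((k : ℝ) - i + 1)) =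
      k.factorial * (k + 1).factorial := by
  induction k with
  | zero => simp
  | succ k ih =>
    rw [Finset.prod_range_succ']
    have : ∏ i ∈ Finset.range k,
        ((((k + 1 : ℕ) : ℝ) - (i + 1 : ℕ)) * (((k + 1 : ℕ) : ℝ) - (i + 1 : ℕ) + 1)) =
        k.factorial * (k + 1).factorial := by
      rw [← ih]
      refine Finset.prod_congr rfl fun i _ ↦ ?_
      push_cast
      ring
    rw [this, Nat.factorial_succ (k + 1), Nat.factorial_succ k]
    push_cast
    ring

/-- A smooth function vanishing at the logarithms of the positive integers decays. -/
lemma abs_le_of_log_zeros (F : ℝ → ℝ) (hF : ContDiff ℝ (⊤ : ℕ∞) F)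
    (h0 : ∀ n : ℕ, F (Real.log (n + 1)) = 0) (k : ℕ) (M : ℝ)
    (hM : ∀ c, |iteratedDeriv k F c| ≤ M) (x : ℝ) (hx : Real.log (k + 1) < x) :
    |F x| ≤ (k + 1).factorial * M * Real.exp (-(k : ℝ) * x) := by
  have hM0 : 0 ≤ M := (abs_nonneg _).trans (hM 0)
  have hkx : (k : ℝ) + 1 < Real.exp x := (Real.log_lt_iff_lt_exp (by positivity)).1 hx
  obtain ⟨p, hp⟩ : ∃ p, ⌊Real.exp x⌋₊ = k + 1 + p :=
    Nat.exists_eq_add_of_le (Nat.le_floor (by push_cast; exact hkx.le))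
  have hle : (k : ℝ) + 1 + p ≤ Real.exp x := by
    have := Nat.floor_le (Real.exp_pos x).le
    rw [hp] at this
    exact_mod_cast this
  have hlt : Real.exp x < (k : ℝ) + 2 + p := by
    have := Nat.lt_floor_add_one (Real.exp x)
    rw [hp] at this
    push_cast at this
    linarith
  rcases hle.eq_or_lt with heq | hlt'
  · have hx0 : F x = 0 := by
      have := h0 (k + p)
      rwa [show (((k + p : ℕ) : ℝ) + 1) = Real.exp x by push_cast; linarith,
        Real.log_exp] at this
    rw [hx0, abs_zero]
    positivity
  set z : ℕ → ℝ := fun i ↦ if i < k then Real.log ((p + 1 + i : ℕ) + 1) else x with hz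
  have hzlt {i : ℕ} (hi : i < k) : z i = Real.log ((p + 1 + i : ℕ) + 1) := if_pos hi
  have hzk : z k = x := if_neg (lt_irrefl k)
  have hcast {i : ℕ} (hi : i < k) : (i : ℝ) + 1 ≤ k := by exact_mod_cast hi
  have hzx {i : ℕ} (hi : i < k) : z i < x := by
    rw [hzlt hi, Real.log_lt_iff_lt_exp (by positivity)]
    have := hcast hi
    push_cast
    linarith
  have hmain := abs_mul_factorial_le_mul_prod k F hF z (by
      intro i hi
      by_cases hi' : i + 1 < k
      · rw [hzlt hi, hzlt hi']
        refine Real.log_lt_log (by positivity) ?_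
        push_cast
        linarith
      · rw [show i + 1 = k by lia, hzk]
        exact hzx hi)
    (fun i hi ↦ by rw [hzlt hi]; exact h0 _) M hM (fun i hi ↦ by rw [hzk]; exact hzx hi)
  rw [hzk] at hmain
  have hprod : ∏ i ∈ Finset.range k, (x - z i) ≤
      k.factorial * (k + 1).factorial * Real.exp (-(k : ℝ) * x) := by
    calc ∏ i ∈ Finset.range k, (x - z i)
        ≤ ∏ i ∈ Finset.range k, ((((k : ℝ) - i) * ((k : ℝ) - i + 1)) * Real.exp (-x)) := by
          refine Finset.prod_le_prod
            (fun i hi ↦ (sub_pos.2 (hzx (Finset.mem_range.1 hi))).le) fun i hi ↦ ?_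
          have hi := Finset.mem_range.1 hi
          have := hcast hi
          have hp0 : (0 : ℝ) ≤ p := p.cast_nonneg
          have hi0 : (0 : ℝ) ≤ i := i.cast_nonneg
          rw [hzlt hi]
          push_cast
          exact sub_log_le_mul_exp_neg (by linarith) (by linarith) (by linarith)
      _ = k.factorial * (k + 1).factorial * Real.exp (-(k : ℝ) * x) := by
          rw [Finset.prod_mul_distrib, prod_range_sub_mul_sub_add_one, Finset.prod_const,
            Finset.card_range, ← Real.exp_nat_mul]
          congr 2
          ring
  have hk0 : (0 : ℝ) < k.factorial := by exact_mod_cast k.factorial_pos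
  refine le_of_mul_le_mul_right ?_ hk0
  calc |F x| * k.factorial
      ≤ M * (k.factorial * (k + 1).factorial * Real.exp (-(k : ℝ) * x)) :=
        hmain.trans (by gcongr)
    _ = (k + 1).factorial * M * Real.exp (-(k : ℝ) * x) * k.factorial := by ring

/-- Decay on the right half-line of a complex smooth function vanishing at the logarithms of the
positive integers. -/
lemma norm_le_of_log_zeros (f : ℝ → ℂ) (hf : ContDiff ℝ (⊤ : ℕ∞) f)
    (h0 : ∀ n : ℕ, f (Real.log (n + 1)) = 0) (k : ℕ) (M : ℝ)
    (hM : ∀ c, ‖iteratedDeriv k f c‖ ≤ M) (x : ℝ) (hx : Real.log (k + 1) < x) :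
    ‖f x‖ ≤ (k + 1).factorial * M * Real.exp (-(k : ℝ) * x) := by
  obtain ⟨L, hL, hLx⟩ := exists_dual_vector'' ℝ (f x)
  have hder (n : ℕ) (c : ℝ) : iteratedDeriv n (L ∘ f) c = L (iteratedDeriv n f c) := by
    rw [iteratedDeriv_eq_iteratedFDeriv,
      L.iteratedFDeriv_comp_left (hf.contDiffAt (x := c)) (mod_cast le_top)]
    simp [iteratedDeriv_eq_iteratedFDeriv]
  have hLle (v : ℂ) : |L v| ≤ ‖v‖ := by
    simpa using L.le_of_opNorm_le hL v
  have := abs_le_of_log_zeros (L ∘ f) (L.contDiff.comp hf) (fun n ↦ by simp [h0 n]) k M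
    (fun c ↦ by rw [hder]; exact (hLle _).trans (hM c)) x hx
  simpa [hLx] using this

theorem decay_from_log_zeros (α : ℝ) (hα0 : 0 < α) (hα1 : α < 1)
    (f : SchwartzMap ℝ ℂ)
    (hf : ∀ n : ℕ, f (Real.log (n + 1)) = 0 ∧ f (-Real.log (n + 1)) = 0)
    (hfhat : ∀ n : ℕ, fourierTransform f ((n : ℝ) ^ α) = 0 ∧
      fourierTransform f (-(n : ℝ) ^ α) = 0) :
    ∀ k : ℕ, 1 ≤ k → ∀ x : ℝ, Real.log (k + 1) < |x| →
      ‖f x‖ ≤ (k : ℝ) * (2 * Real.pi) ^ k * ((Nat.factorial (k + 1) : ℝ)) ^ 3 *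
        weightedIntegral (fourierTransform f) k * Real.exp (-(k : ℝ) * |x|) := by
  intro k hk x hx
  set M := (2 * Real.pi) ^ k * weightedIntegral (fourierTransform f) k with hMdef
  have hM := norm_iteratedDeriv_le_weightedIntegral f k
  have hM0 : 0 ≤ M := (norm_nonneg _).trans (hM 0)
  have key : ‖f x‖ ≤ (k + 1).factorial * M * Real.exp (-(k : ℝ) * |x|) := by
    rcases abs_choice x with h | h
    · rw [h] at hx ⊢
      exact norm_le_of_log_zeros f (f.smooth ⊤) (fun n ↦ (hf n).1) k M hM x hx
    · rw [h] at hx ⊢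
      have := norm_le_of_log_zeros (fun t ↦ f (-t)) ((f.smooth ⊤).comp contDiff_neg)
        (fun n ↦ (hf n).2) k M
        (fun c ↦ by rw [iteratedDeriv_comp_neg, norm_smul]; simpa using hM (-c)) (-x) hx
      simpa only [neg_neg] using this
  have hfac : ((k + 1).factorial : ℝ) ≤ k * ((k + 1).factorial : ℝ) ^ 3 := by
    have h1 : (k + 1).factorial ≤ k * (k + 1).factorial ^ 3 :=
      (Nat.le_self_pow three_ne_zero _).trans (Nat.le_mul_of_pos_left _ hk)
    exact_mod_cast h1
  calc ‖f x‖ ≤ (k + 1).factorial * M * Real.exp (-(k : ℝ) * |x|) := key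
    _ ≤ (k * ((k + 1).factorial : ℝ) ^ 3) * M * Real.exp (-(k : ℝ) * |x|) := by gcongr
    _ = _ := by rw [hMdef]; ring
end

section
/- Let 0 < α < 1 and let f be a Schwartz function on ℝ with f̂(n^α) = f̂(-n^α) = 0 for every natural number n ≥ 0. Then for every natural number j ≥ 1 and every ξ with |ξ| > (2j+1)^α, one has |f̂(ξ)| ≤ (j+1)! (2^{2−α} π)^{j+1} α^j I_j(f) |ξ|^{j(α−1)/α}, where I_j(f) = ∫_ℝ |f(y)| |y|^j dy. -/
open MeasureTheory

open Polynomial in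
theorem Polynomial.iteratedDeriv_eval (p : ℝ[X]) (n : ℕ) :
    iteratedDeriv n (fun x => p.eval x) = fun x => (derivative^[n] p).eval x := by
  induction n generalizing p with
  | zero => simp
  | succ n ih =>
    have h : deriv (fun x => p.eval x) = fun x => (derivative p).eval x := by
      ext x
      simp
    rw [iteratedDeriv_succ', h, ih, Function.iterate_succ_apply]

open Polynomial in
theorem Polynomial.Monic.iterate_derivative_natDegree {p : ℝ[X]} (hp : p.Monic) :
    derivative^[p.natDegree] p = C (p.natDegree.factorial : ℝ) := by
  have h0 : (derivative^[p.natDegree] p).natDegree = 0 := by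
    have := natDegree_iterate_derivative p p.natDegree
    omega
  rw [eq_C_of_natDegree_eq_zero h0, coeff_iterate_derivative]
  simp [hp.coeff_natDegree, Nat.descFactorial_self]

/-- Iterated form of Rolle's theorem. -/
theorem exists_iteratedDeriv_eq_zero_s9 {n : ℕ} {f : ℝ → ℝ} (hf : ContDiff ℝ n f)
    {x : Fin (n + 1) → ℝ} (hx : StrictMono x) (hfx : ∀ i, f (x i) = 0) :
    ∃ c, iteratedDeriv n f c = 0 := by
  induction n generalizing f with
  | zero => exact ⟨x 0, by simpa using hfx 0⟩
  | succ n ih =>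
    have hrolle (i : Fin (n + 1)) :
        ∃ y ∈ Set.Ioo (x i.castSucc) (x i.succ), deriv f y = 0 :=
      exists_deriv_eq_zero (hx Fin.castSucc_lt_succ) hf.continuous.continuousOn
        ((hfx _).trans (hfx _).symm)
    choose y hy hdy using hrolle
    have hy_mono : StrictMono y := Fin.strictMono_iff_lt_succ.2 fun i => by
      have h₁ := (hy i.castSucc).2
      have h₂ := (hy i.succ).1
      rw [Fin.succ_castSucc] at h₁
      exact h₁.trans h₂
    rw [iteratedDeriv_succ']
    exact ih ((contDiff_succ_iff_deriv (n := n)).1 (by exact_mod_cast hf)).2.2 hy_mono hdy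

/-- Error bound for interpolation by the zero polynomial. -/
theorem norm_le_prod_of_iteratedDeriv_bound {E : Type*} [NormedAddCommGroup E] [NormedSpace ℝ E]
    {s : Finset ℝ} {f : ℝ → E} (hf : ContDiff ℝ s.card f) (hs : ∀ a ∈ s, f a = 0) {M : ℝ}
    (hM : ∀ t, ‖iteratedDeriv s.card f t‖ ≤ M) (x : ℝ) :
    ‖f x‖ ≤ M / s.card.factorial * ∏ a ∈ s, |x - a| := by
  have hM0 : 0 ≤ M := (norm_nonneg _).trans (hM 0)
  by_cases hx : x ∈ s
  · rw [hs x hx, norm_zero]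
    positivity
  obtain ⟨L, hL, hLx⟩ := exists_dual_vector'' ℝ (f x)
  set P := Lagrange.nodal s id with hP
  have hPx : P.eval x ≠ 0 := by
    rw [hP, Lagrange.eval_nodal, Finset.prod_ne_zero_iff]
    intro a ha h
    exact hx (by rwa [sub_eq_zero.1 h])
  have hPdeg : P.natDegree = s.card := Lagrange.natDegree_nodal
  have hPmonic : P.Monic := Lagrange.nodal_monic
  set k := L (f x) / P.eval x with hk
  have hLf : ContDiff ℝ s.card (fun t => L (f t)) := L.contDiff.comp hf
  have hkP : ContDiff ℝ s.card (fun t => k * P.eval t) :=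
    contDiff_const.mul (by simpa using P.contDiff_aeval (𝕜 := ℝ) s.card)
  have hcard : (insert x s).card = s.card + 1 := Finset.card_insert_of_notMem hx
  obtain ⟨c, hc⟩ := exists_iteratedDeriv_eq_zero_s9 (f := fun t => L (f t) - k * P.eval t)
    (hLf.sub hkP)
    (x := (insert x s).orderEmbOfFin hcard) (OrderEmbedding.strictMono _) fun i => by
      rcases Finset.mem_insert.1 (Finset.orderEmbOfFin_mem (insert x s) hcard i) with h | h
      · rw [h, hk, div_mul_cancel₀ _ hPx, sub_self]
      · have hz := Lagrange.eval_nodal_at_node (v := id) h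
        rw [id] at hz
        rw [hs _ h, hP, hz]
        simp
  have hLd : iteratedDeriv s.card (fun t => L (f t)) c = L (iteratedDeriv s.card f c) := by
    have := L.iteratedFDeriv_comp_left (x := c) hf.contDiffAt le_rfl
    simp only [iteratedDeriv]
    exact congrArg (fun m => m fun _ => 1) this
  have hPd : iteratedDeriv s.card (fun t => k * P.eval t) c = k * s.card.factorial := by
    simp only [iteratedDeriv_const_mul_field, Polynomial.iteratedDeriv_eval, ← hPdeg,
      hPmonic.iterate_derivative_natDegree, Polynomial.eval_C]
  rw [iteratedDeriv_fun_sub hLf.contDiffAt hkP.contDiffAt, hLd, hPd, sub_eq_zero] at hc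
  have hkM : |k| * s.card.factorial ≤ M := by
    calc |k| * s.card.factorial = ‖L (iteratedDeriv s.card f c)‖ := by
          rw [hc, Real.norm_eq_abs, abs_mul, Nat.abs_cast]
      _ ≤ ‖L‖ * ‖iteratedDeriv s.card f c‖ := L.le_opNorm _
      _ ≤ 1 * M := mul_le_mul hL (hM c) (norm_nonneg _) zero_le_one
      _ = M := one_mul M
  have hfx : ‖f x‖ = |k| * ∏ a ∈ s, |x - a| := by
    have hprod : ∏ a ∈ s, |x - a| = |P.eval x| := by
      rw [hP, Lagrange.eval_nodal, Finset.abs_prod]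
      rfl
    rw [hprod, ← abs_mul, hk, div_mul_cancel₀ _ hPx, hLx]
    simp
  rw [hfx]
  gcongr
  rwa [le_div_iff₀ (by positivity)]

theorem fourierTransform_eq_fourier_neg (f : ℝ → ℂ) (ξ : ℝ) :
    fourierTransform f ξ = FourierTransform.fourier f (-ξ) := by
  rw [fourierTransform, Real.fourier_eq']
  congr with x
  rw [smul_eq_mul, mul_comm]
  congr 2
  simp
  ring

theorem SchwartzMap.integrable_pow_smul (f : SchwartzMap ℝ ℂ) (n : ℕ) :
    Integrable (fun x : ℝ => x ^ n • f x) := by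
  have hmeas : AEStronglyMeasurable (fun x : ℝ => x ^ n • f x) :=
    ((continuous_id.pow n).smul f.continuous).aestronglyMeasurable
  refine (integrable_norm_iff hmeas).1 ?_
  simpa [norm_smul] using f.integrable_pow_mul volume n

theorem SchwartzMap.norm_iteratedDeriv_fourier_le (f : SchwartzMap ℝ ℂ) (n : ℕ) (t : ℝ) :
    ‖iteratedDeriv n (FourierTransform.fourier (f : ℝ → ℂ)) t‖ ≤
      (2 * Real.pi) ^ n * weightedIntegral f n := by
  rw [Real.iteratedDeriv_fourier (N := ⊤) (fun m _ => f.integrable_pow_smul m) le_top,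
    Real.fourier_eq, weightedIntegral, ← integral_const_mul]
  refine (norm_integral_le_integral_norm _).trans_eq ?_
  congr with x
  simp [Circle.norm_smul, abs_of_pos Real.pi_pos, mul_pow]
  ring

/-- Bernoulli-type increment bound for the concave function `t ↦ t ^ α`. -/
theorem Real.rpow_sub_rpow_le {α X Y : ℝ} (hα0 : 0 ≤ α) (hα1 : α ≤ 1) (hX : 0 < X) (hXY : X ≤ Y) :
    Y ^ α - X ^ α ≤ (Y - X) * (α * X ^ (α - 1)) := by
  have h0 : 0 ≤ (Y - X) / X := div_nonneg (sub_nonneg.2 hXY) hX.le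
  have h := rpow_one_add_le_one_add_mul_self (s := (Y - X) / X) (by linarith) hα0 hα1
  have hY : Y = X * (1 + (Y - X) / X) := by
    field_simp
    ring
  calc Y ^ α - X ^ α = X ^ α * (1 + (Y - X) / X) ^ α - X ^ α := by
        conv_lhs => rw [hY, Real.mul_rpow hX.le (by linarith)]
    _ ≤ X ^ α * (1 + α * ((Y - X) / X)) - X ^ α := by gcongr
    _ = (Y - X) * (α * X ^ (α - 1)) := by
        rw [Real.rpow_sub_one hX.ne']
        ring

theorem fourier_decay_from_power_zeros (α : ℝ) (hα0 : 0 < α) (hα1 : α < 1)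
    (f : SchwartzMap ℝ ℂ)
    (hfhat : ∀ n : ℕ, fourierTransform f ((n : ℝ) ^ α) = 0 ∧
      fourierTransform f (-(n : ℝ) ^ α) = 0) :
    ∀ j : ℕ, 1 ≤ j → ∀ ξ : ℝ, (2 * (j : ℝ) + 1) ^ α < |ξ| →
      ‖fourierTransform f ξ‖ ≤ (Nat.factorial (j + 1) : ℝ) *
        ((2 : ℝ) ^ (2 - α) * Real.pi) ^ (j + 1) * α ^ j * weightedIntegral f j *
        |ξ| ^ ((j : ℝ) * (α - 1) / α) := by
  intro j _ ξ hξ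
  have hξ0 : 0 < |ξ| := lt_of_le_of_lt (by positivity) hξ
  set X := |ξ| ^ α⁻¹ with hXdef
  have hX : 0 < X := Real.rpow_pos_of_pos hξ0 _
  have hXα : X ^ α = |ξ| := Real.rpow_inv_rpow hξ0.le hα0.ne'
  obtain ⟨σ, hσ, hσξ⟩ : ∃ σ : ℝ, (σ = 1 ∨ σ = -1) ∧ -ξ = σ * |ξ| := by
    rcases le_total 0 ξ with h | h
    · exact ⟨-1, Or.inr rfl, by rw [abs_of_nonneg h]; ring⟩
    · exact ⟨1, Or.inl rfl, by rw [abs_of_nonpos h]; ring⟩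
  have hσabs : |σ| = 1 := by rcases hσ with rfl | rfl <;> simp
  have hσ0 : σ ≠ 0 := by rcases hσ with rfl | rfl <;> norm_num
  let node : ℕ → ℝ := fun i => σ * ((⌈X⌉₊ + i : ℕ) : ℝ) ^ α
  have hinj : Function.Injective node := fun a b hab => by
    have h := (Real.rpow_left_inj (by positivity) (by positivity) hα0.ne').1
      (mul_left_cancel₀ hσ0 hab)
    have h' := Nat.cast_injective h
    omega
  let s : Finset ℝ := (Finset.range j).image node
  have hcard : s.card = j := by
    rw [Finset.card_image_of_injective _ hinj, Finset.card_range]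
  have hzero : ∀ a ∈ s, FourierTransform.fourier (f : ℝ → ℂ) a = 0 := by
    intro a ha
    obtain ⟨i, -, rfl⟩ := Finset.mem_image.1 ha
    rw [← neg_neg (node i), ← fourierTransform_eq_fourier_neg]
    rcases hσ with rfl | rfl
    · simpa [node] using (hfhat (⌈X⌉₊ + i)).2
    · simpa [node] using (hfhat (⌈X⌉₊ + i)).1
  have hdist (i : ℕ) : |-ξ - node i| ≤ ((i + 1 : ℕ) : ℝ) * (α * X ^ (α - 1)) := by
    have hle : X ≤ ((⌈X⌉₊ + i : ℕ) : ℝ) := (Nat.le_ceil X).trans (by simp)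
    have hlt : ((⌈X⌉₊ + i : ℕ) : ℝ) - X ≤ ((i + 1 : ℕ) : ℝ) := by
      have := Nat.ceil_lt_add_one hX.le
      push_cast
      linarith
    have habs : |-ξ - node i| = ((⌈X⌉₊ + i : ℕ) : ℝ) ^ α - X ^ α := by
      rw [hσξ, ← hXα, ← mul_sub, abs_mul, hσabs, one_mul, abs_sub_comm, abs_of_nonneg]
      exact sub_nonneg.2 (Real.rpow_le_rpow hX.le hle hα0.le)
    rw [habs]
    exact (Real.rpow_sub_rpow_le hα0.le hα1.le hX hle).trans (by gcongr)
  have hprod : ∏ a ∈ s, |-ξ - a| ≤ (j.factorial : ℝ) * (α * X ^ (α - 1)) ^ j := by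
    rw [Finset.prod_image hinj.injOn]
    refine (Finset.prod_le_prod (fun _ _ => abs_nonneg _) fun i _ => hdist i).trans_eq ?_
    rw [Finset.prod_mul_distrib, Finset.prod_const, Finset.card_range, ← Nat.cast_prod,
      Finset.prod_range_add_one_eq_factorial]
  have hsmooth : ContDiff ℝ s.card (FourierTransform.fourier (f : ℝ → ℂ)) := by
    rw [← SchwartzMap.fourier_coe]
    exact (FourierTransform.fourier f).smooth _
  have hI : 0 ≤ weightedIntegral f j := integral_nonneg fun y => by positivity
  have hXpow : (X ^ (α - 1)) ^ j = |ξ| ^ ((j : ℝ) * (α - 1) / α) := by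
    rw [hXdef, ← Real.rpow_natCast, ← Real.rpow_mul hξ0.le, ← Real.rpow_mul hξ0.le]
    congr 1
    field_simp
  have hconst : (2 * Real.pi) ^ j ≤
      ((j + 1).factorial : ℝ) * ((2 : ℝ) ^ (2 - α) * Real.pi) ^ (j + 1) := by
    have h2 : (2 : ℝ) ≤ 2 ^ (2 - α) := by
      simpa using Real.rpow_le_rpow_of_exponent_le one_le_two (by linarith : 1 ≤ 2 - α)
    have hpi := Real.two_le_pi
    calc (2 * Real.pi) ^ j ≤ (2 * Real.pi) ^ (j + 1) :=
          pow_le_pow_right₀ (by linarith) j.le_succ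
      _ ≤ ((2 : ℝ) ^ (2 - α) * Real.pi) ^ (j + 1) := by gcongr
      _ ≤ _ := le_mul_of_one_le_left (by positivity)
          (by exact_mod_cast Nat.factorial_pos (j + 1))
  have hbound := norm_le_prod_of_iteratedDeriv_bound hsmooth hzero
    (fun t => f.norm_iteratedDeriv_fourier_le s.card t) (-ξ)
  rw [hcard] at hbound
  rw [fourierTransform_eq_fourier_neg]
  calc _ ≤ _ := hbound
    _ ≤ (2 * Real.pi) ^ j * weightedIntegral f j / j.factorial *
        ((j.factorial : ℝ) * (α * X ^ (α - 1)) ^ j) := by gcongr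
    _ = (2 * Real.pi) ^ j * (α ^ j * weightedIntegral f j *
        |ξ| ^ ((j : ℝ) * (α - 1) / α)) := by
        rw [← hXpow]
        field_simp
        ring
    _ ≤ ((j + 1).factorial : ℝ) * ((2 : ℝ) ^ (2 - α) * Real.pi) ^ (j + 1) *
        (α ^ j * weightedIntegral f j * |ξ| ^ ((j : ℝ) * (α - 1) / α)) := by gcongr
    _ = _ := by ring
end
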